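/- Let p and q be distinct odd primes and let s, t be positive integers such that either one of s, t is greater than 2, or both s ≥ 2 and t ≥ 2. Set n = 2 · p^s · q^t and suppose d = n^2 + 1 is squarefree with d ≡ 5 (mod 8). If the class number of Q(√d) equals 4, then the ideal class group of Q(√d) is isomorphic to Z/2Z × Z/2Z (the Klein four-group). -/

import Mathlib

/-- Descent along the fundamental unit `n + √(n^2+1)`. -/
theorem descent (n : ℤ) (hn : 0 < n) : ∀ (N : ℕ) (x y : ℤ), y.natAbs = N →
    |x ^ 2 - (n ^ 2 + 1) * y ^ 2| < 2 * n →
    ∃ w : ℤ, w ^ 2 = |x ^ 2 - (n ^ 2 + 1) * y ^ 2| ∧ w ∣ x ∧ w ∣ y := by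
  have key : ∀ (N : ℕ), (∀ (x y : ℤ), y.natAbs < N →
    |x ^ 2 - (n ^ 2 + 1) * y ^ 2| < 2 * n →
    ∃ w : ℤ, w ^ 2 = |x ^ 2 - (n ^ 2 + 1) * y ^ 2| ∧ w ∣ x ∧ w ∣ y) → 
    ∀ x y : ℤ, 0 ≤ x → 0 ≤ y → y.natAbs = N → |x ^ 2 - (n ^ 2 + 1) * y ^ 2| < 2 * n →
    ∃ w : ℤ, w ^ 2 = |x ^ 2 - (n ^ 2 + 1) * y ^ 2| ∧ w ∣ x ∧ w ∣ y := by
    intro N ih x y hx hy hN h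
    rcases hy.eq_or_lt with h0 | hy
    · subst h0
      exact ⟨x, by simp, dvd_rfl, by simp⟩
    have hny : n ≤ n * y ^ 2 := le_mul_of_one_le_right hn.le (by nlinarith)
    have h1 : x < (n + 1) * y := by
      by_contra! hc
      have := (abs_lt.mp h).2
      have h2 : ((n + 1) * y) ^ 2 ≤ x ^ 2 := by gcongr
      nlinarith
    have h2 : (n - 1) * y < x := by
      by_contra! hc
      have := (abs_lt.mp h).1
      have h2 : x ^ 2 ≤ ((n - 1) * y) ^ 2 := by gcongr
      nlinarith
    have e : |(-n * x + (n ^ 2 + 1) * y) ^ 2 - (n ^ 2 + 1) * (x - n * y) ^ 2|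
        = |x ^ 2 - (n ^ 2 + 1) * y ^ 2| := by
      rw [← abs_neg]; congr 1; ring
    have hlt : (x - n * y).natAbs < N := by
      have a1 : x - n * y < y := by linarith
      have a2 : - y < x - n * y := by linarith
      omega
    obtain ⟨w, hw, ha, hb⟩ := ih (-n * x + (n ^ 2 + 1) * y) (x - n * y) hlt (by rwa [e])
    rw [e] at hw
    have ex : x = n * (-n * x + (n ^ 2 + 1) * y) + (n ^ 2 + 1) * (x - n * y) := by ring
    have ey : y = (-n * x + (n ^ 2 + 1) * y) + n * (x - n * y) := by ring
    refine ⟨w, hw, ?_, ?_⟩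
    · rw [ex]; exact (ha.mul_left n).add (hb.mul_left (n ^ 2 + 1))
    · rw [ey]; exact ha.add (hb.mul_left n)
  intro N
  induction N using Nat.strong_induction_on with
  | _ N ih =>
    intro x y hy h
    have h' : |(|x|) ^ 2 - (n ^ 2 + 1) * (|y|) ^ 2| < 2 * n := by simpa only [sq_abs] using h
    obtain ⟨w, hw, ha, hb⟩ := key N (fun a b hb => ih b.natAbs hb a b rfl)
      |x| |y| (abs_nonneg _) (abs_nonneg _) (by rw [Int.natAbs_abs]; exact hy) h'
    exact ⟨w, by simpa only [sq_abs] using hw, by simpa using ha, by simpa using hb⟩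

/-- Conjugation on a real quadratic field. -/
theorem exists_conj (K : Type) [Field K] [NumberField K]
    (hdeg : Module.finrank ℚ K = 2) (d : ℕ) (hd : ¬ IsSquare d) (α : K) (hα : α ^ 2 = (d : K)) :
    ∃ σ : K ≃ₐ[ℚ] K, σ α = -α ∧ (∀ z, σ (σ z) = z) ∧
      ∀ z, IsIntegral ℤ z → σ z = z → ∃ k : ℤ, (k : K) = z := by
  have : Algebra.IsQuadraticExtension ℚ K := ⟨hdeg⟩
  have hcard := IsGalois.card_aut_eq_finrank ℚ K
  rw [hdeg] at hcard
  obtain ⟨σ, hσ, hu⟩ := (Nat.card_eq_two_iff' (1 : Gal(K/ℚ))).mp hcard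
  have hrat : ∀ z, σ z = z → ∃ r : ℚ, algebraMap ℚ K r = z := by
    intro z hz
    have := (IsGalois.mem_bot_iff_fixed (F := ℚ) z).mpr (fun f => by
      by_cases hf : f = 1
      · simp [hf]
      · rw [hu f hf]; exact hz)
    exact IntermediateField.mem_bot.mp this
  refine ⟨σ, ?_, ?_, ?_⟩
  · have h1 : (σ α) ^ 2 = α ^ 2 := by rw [← map_pow, hα, map_natCast]
    rcases sq_eq_sq_iff_eq_or_eq_neg.mp h1 with h | h
    · exfalso
      obtain ⟨r, hr⟩ := hrat α h
      apply hd
      rw [← Rat.isSquare_natCast_iff]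
      refine ⟨r, ?_⟩
      apply (algebraMap ℚ K).injective
      rw [map_mul, hr, map_natCast, ← hα, sq]
    · exact h
  · intro z
    have : σ ^ 2 = 1 := by rw [← hcard]; exact pow_card_eq_one'
    have h := congrArg (fun f => f z) this
    simpa [sq] using h
  · intro z hz hf
    obtain ⟨r, hr⟩ := hrat z hf
    rw [← hr, isIntegral_algebraMap_iff (algebraMap ℚ K).injective] at hz
    obtain ⟨k, hk⟩ := IsIntegrallyClosed.isIntegral_iff.mp hz
    exact ⟨k, by rw [← hr, ← hk]; simp⟩

theorem coords (K : Type) [Field K] [NumberField K] (d : ℕ) (hd0 : d ≠ 0)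
    (hsf : Squarefree d) (α : K) (hα : α ^ 2 = (d : K)) (σ : K ≃ₐ[ℚ] K) (hσ : σ α = -α)
    (hσσ : ∀ z, σ (σ z) = z)
    (hint : ∀ z, IsIntegral ℤ z → σ z = z → ∃ k : ℤ, (k : K) = z) (β : K) (hβ : IsIntegral ℤ β) :
    ∃ x y k : ℤ, 2 * β = x + y * α ∧ x ^ 2 - d * y ^ 2 = 4 * k ∧ β * σ β = k := by
  have hβ' : IsIntegral ℤ (σ β) := hβ.map (σ.toAlgHom.restrictScalars ℤ)
  have hαi : IsIntegral ℤ α := by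
    apply IsIntegral.of_pow (n := 2) (by norm_num)
    rw [hα]
    have := isIntegral_algebraMap (R := ℤ) (A := K) (x := (d : ℤ))
    simpa using this
  obtain ⟨u, hu⟩ := hint (β + σ β) (hβ.add hβ') (by rw [map_add, hσσ, add_comm])
  obtain ⟨v, hv⟩ := hint (α * (β - σ β)) (hαi.mul (hβ.sub hβ'))
    (by rw [map_mul, map_sub, hσσ, hσ]; ring)
  obtain ⟨k, hk⟩ := hint (β * σ β) (hβ.mul hβ') (by rw [map_mul, hσσ, mul_comm])
  have h1 : (4 * k * d : ℤ) = d * u ^ 2 - v ^ 2 := by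
    have : (((4 * k * d : ℤ)) : K) = ((d * u ^ 2 - v ^ 2 : ℤ) : K) := by
      push_cast
      rw [hu, hv, hk, ← hα]; ring
    exact_mod_cast this
  have hdv : (d : ℤ) ∣ v := by
    have hs : Squarefree (d : ℤ) := Int.squarefree_natCast.mpr hsf
    rw [← hs.dvd_pow_iff_dvd (n := 2) (by norm_num)]
    exact ⟨u ^ 2 - 4 * k, by linarith⟩
  obtain ⟨y, rfl⟩ := hdv
  have hdz : (d : ℤ) ≠ 0 := by exact_mod_cast hd0
  have hdK : (d : K) ≠ 0 := by exact_mod_cast hd0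
  refine ⟨u, y, k, ?_, ?_, hk.symm⟩
  · apply mul_left_cancel₀ hdK
    push_cast at hv
    have : (d : K) * (β - σ β) = d * (y * α) := by
      rw [show (d : K) * (y * α) = α * (d * y) by ring, hv, ← hα]; ring
    rw [hu]; linear_combination this
  · apply mul_left_cancel₀ hdz
    linarith

open NumberField in
theorem main_bound (K : Type) [Field K] [NumberField K]
    (hdeg : Module.finrank ℚ K = 2) (m d : ℕ) (hm : 0 < m) (hd : d = 4 * m ^ 2 + 1)
    (hsf : Squarefree d) (α : K) (hα : α ^ 2 = (d : K))
    (hcl : ∀ c : ClassGroup (𝓞 K), c ^ 4 = 1) (p : ℕ) (hp : p.Prime) (hpm : p ∣ m) :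
    m ≤ p ^ 4 := by
  by_contra! hlt
  have hnsq : ¬ IsSquare d := by
    rintro ⟨r, hr⟩
    have h1 : 2 * m < r := by nlinarith
    nlinarith
  obtain ⟨σ, hσ, hσσ, hint⟩ := exists_conj K hdeg d hnsq α hα
  have hco := coords K d (by omega) hsf α hα σ hσ hσσ hint
  have h2 : (2 : K) ≠ 0 := by norm_num
  have hpK : (p : K) ≠ 0 := by exact_mod_cast hp.ne_zero
  have hpO : (p : 𝓞 K) ≠ 0 := by exact_mod_cast hp.ne_zero
  obtain ⟨ωK, hωα⟩ : ∃ w : K, w = (1 + α) / 2 := ⟨_, rfl⟩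
  have hωK : ωK ^ 2 = ωK + (m : K) ^ 2 := by
    have : α ^ 2 = 4 * (m : K) ^ 2 + 1 := by rw [hα, hd]; push_cast; ring
    rw [hωα]; linear_combination this / 4
  have hωi : IsIntegral ℤ ωK := by
    refine ⟨Polynomial.X ^ 2 - Polynomial.X - Polynomial.C (((m ^ 2 : ℕ) : ℤ)), ?_, ?_⟩
    · monicity!
    · simp only [Polynomial.eval₂_sub, Polynomial.eval₂_pow, Polynomial.eval₂_X, Polynomial.eval₂_C, hωK]
      simp
  have inj : ∀ a b : 𝓞 K, algebraMap (𝓞 K) K a = algebraMap (𝓞 K) K b → a = b :=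
    fun a b h => FaithfulSMul.algebraMap_injective (𝓞 K) K h
  obtain ⟨ω, hωc⟩ : ∃ w : 𝓞 K, algebraMap (𝓞 K) K w = ωK := ⟨⟨ωK, hωi⟩, rfl⟩
  have hω : ω ^ 2 = ω + (m : 𝓞 K) ^ 2 := by
    apply inj; simpa [hωc] using hωK
  let τ : 𝓞 K ≃+* 𝓞 K := RingOfIntegers.mapRingEquiv σ.toRingEquiv
  have hτ : ∀ z : 𝓞 K, algebraMap (𝓞 K) K (τ z) = σ (algebraMap (𝓞 K) K z) := fun z => rfl
  have hτω : τ ω = 1 - ω := by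
    apply inj
    rw [hτ, map_sub, map_one, hωc, hωα]
    rw [map_div₀, map_add, map_one, hσ, map_ofNat]
    field_simp; ring
  have hpnu : ¬ IsUnit (p : 𝓞 K) := by
    intro hu
    have : (p : 𝓞 K) ∣ 1 := isUnit_iff_dvd_one.mp hu
    obtain ⟨z, hz⟩ := this
    have hz' := congrArg (fun t : 𝓞 K => (t : K)) hz
    obtain ⟨x, y, k, -, -, h3⟩ := hco z z.2
    have hs := congrArg σ hz'
    simp only [map_one, map_mul, map_natCast] at hz' hs
    have h4 : ((p * p * k : ℤ) : K) = ((1 : ℤ) : K) := by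
      push_cast; rw [← h3]; linear_combination (-(p : K) * σ z) * hz' - hs
    have h5 : (p : ℤ) * p * k = 1 := by exact_mod_cast h4
    have h6 : (p : ℤ) ∣ 1 := ⟨p * k, by linarith⟩
    have := Int.natCast_dvd_natCast.mp (by simpa using h6 : (p : ℤ) ∣ ((1 : ℕ) : ℤ))
    exact hp.one_lt.ne' (Nat.dvd_one.mp this)
  have hpω : ¬ (p : 𝓞 K) ∣ ω := by
    intro h
    apply hpnu
    have h' := map_dvd τ h
    rw [map_natCast, hτω] at h'
    apply isUnit_iff_dvd_one.mpr
    simpa using h.add h'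
  let P : Ideal (𝓞 K) := Ideal.span {(p : 𝓞 K), ω}
  have hP0 : P ≠ ⊥ := by
    intro h
    have h1 : (p : 𝓞 K) ∈ P := Ideal.subset_span (by simp)
    rw [h] at h1
    exact hpO (Ideal.mem_bot.mp h1)
  have hPP : P * P.map (τ : 𝓞 K →+* 𝓞 K) = Ideal.span {(p : 𝓞 K)} := by
    have : P.map (τ : 𝓞 K →+* 𝓞 K) = Ideal.span {(p : 𝓞 K), 1 - ω} := by
      simp only [P, Ideal.map_span, Set.image_pair]
      simp [hτω]
    rw [this]
    simp only [P]
    obtain ⟨c, hc⟩ := hpm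
    have hωω : ω * (1 - ω) = p * (- (p * c ^ 2)) := by
      rw [hc] at hω; push_cast at hω; linear_combination - hω
    rw [Ideal.span_pair_mul_span_pair]
    apply le_antisymm
    · rw [Ideal.span_le]
      rintro z (rfl | rfl | rfl | rfl)
      · exact Ideal.mem_span_singleton.mpr ⟨p, rfl⟩
      · exact Ideal.mem_span_singleton.mpr ⟨1 - ω, rfl⟩
      · exact Ideal.mem_span_singleton.mpr ⟨ω, mul_comm _ _⟩
      · exact Ideal.mem_span_singleton.mpr ⟨_, hωω⟩
    · rw [Ideal.span_singleton_le_iff_mem]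
      have e : (p : 𝓞 K) = p * (1 - ω) + ω * p := by ring
      have e1 := Ideal.add_mem (Ideal.span {(p : 𝓞 K) * p, p * (1 - ω), ω * p, ω * (1 - ω)})
        (a := p * (1 - ω)) (b := ω * p)
        (Ideal.subset_span (by simp)) (Ideal.subset_span (by simp))
      rwa [← e] at e1
  have hprin : (P ^ 4).IsPrincipal := by
    have h1 := hcl (ClassGroup.mk0 ⟨P, mem_nonZeroDivisors_iff_ne_zero.mpr hP0⟩)
    rw [← map_pow] at h1
    exact (ClassGroup.mk0_eq_one_iff _).mp h1
  obtain ⟨β, hβ⟩ := hprin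
  have hβ : P ^ 4 = Ideal.span {β} := hβ
  have hpβ : ¬ (p : 𝓞 K) ∣ β := by
    intro h
    have h1 : ω ^ 4 ∈ P ^ 4 := Ideal.pow_mem_pow (Ideal.subset_span (by simp)) 4
    rw [hβ, Ideal.mem_span_singleton] at h1
    have h2 := h.trans h1
    apply hpω
    have h3 : (p : 𝓞 K) ∣ (m : 𝓞 K) := by exact_mod_cast (Nat.cast_dvd_cast hpm)
    have e : ω = ω ^ 4 - m * (m * (2 * ω + m ^ 2 + 1)) := by
      linear_combination -(ω ^ 2 + ω + m ^ 2 + 1) * hω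
    rw [e]
    exact h2.sub (h3.mul_right _)
  have hnorm : Ideal.span {β * τ β} = Ideal.span {(p : 𝓞 K) ^ 4} := by
    rw [← Ideal.span_singleton_mul_span_singleton, ← Ideal.span_singleton_pow, ← hPP, mul_pow,
      ← Ideal.map_pow, hβ, Ideal.map_span]
    simp
  rw [Ideal.span_singleton_eq_span_singleton] at hnorm
  obtain ⟨x, y, k, h1, h3, h4⟩ := hco (algebraMap (𝓞 K) K β) β.2
  have hkO : β * τ β = (k : 𝓞 K) := by
    apply inj
    rw [map_mul, hτ, h4]; simp
  rw [hkO] at hnorm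
  have hdvd : ∀ a b : ℤ, a ≠ 0 → (a : 𝓞 K) ∣ (b : 𝓞 K) → a ∣ b := by
    rintro a b ha ⟨z, hz⟩
    have hz' : (b : K) = a * z := by
      have := congrArg (fun t : 𝓞 K => (t : K)) hz
      simpa using this
    have haK : (a : K) ≠ 0 := by exact_mod_cast ha
    obtain ⟨c, hc⟩ := hint z z.2 (by
      have := congrArg σ hz'
      simp only [map_intCast, map_mul] at this
      exact mul_left_cancel₀ haK (this.symm.trans hz'))
    exact ⟨c, by rw [← hc] at hz'; exact_mod_cast hz'⟩
  have hp4 : ((p : ℤ) ^ 4) ≠ 0 := pow_ne_zero _ (by exact_mod_cast hp.ne_zero)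
  have hd1 : (p : ℤ) ^ 4 ∣ k := hdvd _ _ hp4 (by push_cast; exact hnorm.symm.dvd)
  have hk0 : k ≠ 0 := by
    rintro rfl
    have h5 := hnorm.dvd
    rw [Int.cast_zero, zero_dvd_iff] at h5
    exact pow_ne_zero 4 hpO h5
  have hd2 : k ∣ (p : ℤ) ^ 4 := hdvd _ _ hk0 (by push_cast; exact hnorm.dvd)
  have hkabs : |k| = (p : ℤ) ^ 4 := by
    rw [Int.abs_eq_natAbs, Int.natAbs_eq_of_dvd_dvd hd2 hd1, ← Int.abs_eq_natAbs]
    exact abs_of_nonneg (by positivity)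
  have hdz : (d : ℤ) = (2 * (m : ℤ)) ^ 2 + 1 := by rw [hd]; push_cast; ring
  have h3' : |x ^ 2 - ((2 * (m : ℤ)) ^ 2 + 1) * y ^ 2| = 4 * (p : ℤ) ^ 4 := by
    rw [← hdz, h3, abs_mul, hkabs]; norm_num
  have hltz : (p : ℤ) ^ 4 < m := by exact_mod_cast hlt
  obtain ⟨w, hw, hwx, hwy⟩ := descent (2 * m) (by omega) _ x y rfl (by rw [h3']; linarith)
  have hpw : (2 * p : ℤ) ∣ w := by
    rw [← Int.pow_dvd_pow_iff (n := 2) (by norm_num), hw, h3']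
    exact ⟨p ^ 2, by ring⟩
  obtain ⟨a, ha⟩ := hpw.trans hwx
  obtain ⟨b, hb⟩ := hpw.trans hwy
  apply hpβ
  refine ⟨(a : 𝓞 K) + b * (2 * ω - 1), ?_⟩
  apply inj
  apply mul_left_cancel₀ h2
  rw [h1, ha, hb]
  simp only [map_mul, map_add, map_sub, map_one, map_intCast, map_natCast, map_ofNat, hωc, hωα]
  push_cast
  ring

theorem class_group_klein_of_two_mul_two_prime_pows
    (p q : ℕ) (hp : p.Prime) (hq : q.Prime) (hpq : p ≠ q)
    (hpodd : p ≠ 2) (hqodd : q ≠ 2)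
    (s t : ℕ) (hs : 1 ≤ s) (ht : 1 ≤ t)
    (hst : 2 < s ∨ 2 < t ∨ (2 ≤ s ∧ 2 ≤ t))
    (n : ℕ) (hn : n = 2 * p ^ s * q ^ t) (d : ℕ) (hd : d = n ^ 2 + 1)
    (hsf : Squarefree d) (hmod : d % 8 = 5)
    (K : Type) [Field K] [NumberField K]
    (hdeg : Module.finrank ℚ K = 2) (α : K) (hα : α ^ 2 = (d : K))
    (hcl : NumberField.classNumber K = 4) :
    Nonempty (ClassGroup (NumberField.RingOfIntegers K) ≃*
      (Multiplicative (ZMod 2) × Multiplicative (ZMod 2))) := by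
  exfalso
  have hcl4 : ∀ c : ClassGroup (NumberField.RingOfIntegers K), c ^ 4 = 1 := by
    intro c
    rw [← hcl, NumberField.classNumber]
    exact pow_card_eq_one
  have hp1 := hp.one_lt
  have hq1 := hq.one_lt
  have hm : 0 < p ^ s * q ^ t := by positivity
  have hd' : d = 4 * (p ^ s * q ^ t) ^ 2 + 1 := by rw [hd, hn]; ring
  have hP := main_bound K hdeg _ d hm hd' hsf α hα hcl4 p hp
    ((dvd_pow_self p (by omega)).mul_right _)
  have hQ := main_bound K hdeg _ d hm hd' hsf α hα hcl4 q hq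
    ((dvd_pow_self q (by omega)).mul_left _)
  have aux : ∀ p q s t : ℕ, 1 < p → 1 < q → 2 < s → 1 ≤ t → p ^ s * q ^ t ≤ p ^ 4 →
      p ^ s * q ^ t ≤ q ^ 4 → p = q := by
    intro p q s t hp hq hs ht h1 h2
    have a1 : p ^ 3 * q ^ 1 ≤ p ^ s * q ^ t :=
      Nat.mul_le_mul (Nat.pow_le_pow_right (by omega) hs) (Nat.pow_le_pow_right (by omega) ht)
    have b1 : p ^ 3 * q ≤ p ^ 3 * p := by
      calc _ ≤ _ := by simpa using a1
        _ ≤ _ := h1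
        _ = _ := by ring
    have b2 : q * p ^ 3 ≤ q * q ^ 3 := by
      calc _ = p ^ 3 * q ^ 1 := by ring
        _ ≤ _ := a1
        _ ≤ _ := h2
        _ = _ := by ring
    have c1 : q ≤ p := Nat.le_of_mul_le_mul_left b1 (by positivity)
    have c2 : p ^ 3 ≤ q ^ 3 := Nat.le_of_mul_le_mul_left b2 (by positivity)
    have c3 : p ≤ q := (Nat.pow_le_pow_iff_left (by norm_num)).mp c2
    omega
  rcases hst with h | h | ⟨h, h'⟩
  · exact hpq (aux p q s t hp1 hq1 h ht hP hQ)
  · exact hpq (aux q p t s hq1 hp1 h hs (by rwa [mul_comm]) (by rwa [mul_comm])).symm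
  · have a1 : p ^ 2 * q ^ 2 ≤ p ^ s * q ^ t :=
      Nat.mul_le_mul (Nat.pow_le_pow_right (by omega) h) (Nat.pow_le_pow_right (by omega) h')
    have b1 : p ^ 2 * q ^ 2 ≤ p ^ 2 * p ^ 2 := by
      rw [← pow_add]; exact a1.trans hP
    have b2 : q ^ 2 * p ^ 2 ≤ q ^ 2 * q ^ 2 := by
      rw [← pow_add, mul_comm]; exact a1.trans hQ
    have c1 := (Nat.pow_le_pow_iff_left (by norm_num)).mp
      (Nat.le_of_mul_le_mul_left b1 (by positivity))
    have c2 := (Nat.pow_le_pow_iff_left (by norm_num)).mp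
      (Nat.le_of_mul_le_mul_left b2 (by positivity))
    omega
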